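/- Let n ≥ 5 and consider a 2-edge-colouring of K_n with at least n blue edges and at least one red edge. Then K_n contains a copy of K_{1,3} with exactly two blue edges and one red edge. -/

import Mathlib

/-- The set of red edges of a 2-edge-colouring of `K_n`
    (`true` = red, `false` = blue). -/
def redEdges (n : ℕ) (c : Sym2 (Fin n) → Bool) : Finset (Sym2 (Fin n)) :=
  (⊤ : SimpleGraph (Fin n)).edgeFinset.filter (fun e => c e = true)

/-- The set of blue edges of a 2-edge-colouring of `K_n`. -/
def blueEdges (n : ℕ) (c : Sym2 (Fin n) → Bool) : Finset (Sym2 (Fin n)) :=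
  (⊤ : SimpleGraph (Fin n)).edgeFinset.filter (fun e => c e = false)

/-- The graph formed by the blue edges. -/
def blueGraph (n : ℕ) (c : Sym2 (Fin n) → Bool) : SimpleGraph (Fin n) where
  Adj a b := a ≠ b ∧ c s(a, b) = false
  symm := ⟨fun a b h => ⟨h.1.symm, by rw [Sym2.eq_swap]; exact h.2⟩⟩
  loopless := ⟨fun _ h => h.1 rfl⟩

instance (n : ℕ) (c : Sym2 (Fin n) → Bool) : DecidableRel (blueGraph n c).Adj :=
  fun a b => inferInstanceAs (Decidable (a ≠ b ∧ c s(a, b) = false))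

lemma edgeFinset_blueGraph (n : ℕ) (c : Sym2 (Fin n) → Bool) :
    (blueGraph n c).edgeFinset = blueEdges n c := by
  ext e
  induction e with
  | _ a b =>
    rw [SimpleGraph.mem_edgeFinset]
    simp [blueGraph, blueEdges]

/-- If every vertex of degree at least two is adjacent to all other vertices, a graph with at
least as many edges as vertices is complete. -/
lemma SimpleGraph.eq_top_of_card_le_card_edgeFinset {V : Type*} [Fintype V] [DecidableEq V]
    [Nonempty V] (G : SimpleGraph V) [DecidableRel G.Adj]
    (hG : ∀ v, 1 < G.degree v → ∀ w, v ≠ w → G.Adj v w)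
    (hcard : Fintype.card V ≤ G.edgeFinset.card) : G = ⊤ := by
  have hsum := G.sum_degrees_eq_twice_card_edges
  have hpos : 0 < Fintype.card V := Fintype.card_pos
  obtain ⟨u, hu⟩ : ∃ u, 1 < G.degree u := by
    by_contra! h
    have := Finset.sum_le_card_nsmul Finset.univ (fun v => G.degree v) 1 fun v _ => h v
    simp only [Finset.card_univ, smul_eq_mul, mul_one] at this
    omega
  obtain ⟨v, hvu, hv⟩ : ∃ v, v ≠ u ∧ 1 < G.degree v := by
    by_contra! h
    have h₁ := Finset.sum_le_card_nsmul (Finset.univ.erase u) (fun v => G.degree v) 1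
      fun v hv => h v (Finset.ne_of_mem_erase hv)
    have h₂ := Finset.add_sum_erase Finset.univ (fun v => G.degree v) (Finset.mem_univ u)
    have h₃ := G.degree_lt_card_verts u
    simp only [Finset.card_erase_of_mem (Finset.mem_univ u), Finset.card_univ, smul_eq_mul,
      mul_one] at h₁
    omega
  ext x y
  refine ⟨fun h => h.ne, fun hxy => hG x ?_ y hxy⟩
  by_cases hxu : x = u
  · rwa [hxu]
  by_cases hxv : x = v
  · rwa [hxv]
  refine Finset.one_lt_card.2 ⟨u, ?_, v, ?_, hvu.symm⟩
  · simpa using (hG u hu x (Ne.symm hxu)).symm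
  · simpa using (hG v hv x (Ne.symm hxv)).symm

/-- Let `n ≥ 5` and consider a 2-edge-colouring of `K_n` with at least `n` blue edges and
at least one red edge.  Then `K_n` contains a copy of the star `K_{1,3}` (centre `v`,
leaves `a₁, a₂, a₃`, all four vertices distinct) with exactly two blue edges and one red
edge. -/
theorem star_two_blue_one_red (n : ℕ) (hn : 5 ≤ n) (c : Sym2 (Fin n) → Bool)
    (hblue : n ≤ (blueEdges n c).card) (hred : 1 ≤ (redEdges n c).card) :
    ∃ v a₁ a₂ a₃ : Fin n, ([v, a₁, a₂, a₃] : List (Fin n)).Nodup ∧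
      c s(v, a₁) = false ∧ c s(v, a₂) = false ∧ c s(v, a₃) = true := by
  by_contra! hstar
  obtain ⟨e, he⟩ := Finset.card_pos.1 hred
  have : Nonempty (Fin n) := ⟨⟨0, by omega⟩⟩
  have htop : blueGraph n c = ⊤ := by
    refine SimpleGraph.eq_top_of_card_le_card_edgeFinset _ (fun v hv w hvw => ⟨hvw, ?_⟩) ?_
    · obtain ⟨a, ha, b, hb, hab⟩ := Finset.one_lt_card.1 hv
      rw [SimpleGraph.mem_neighborFinset] at ha hb
      by_contra hw
      refine hstar v a b w ?_ ha.2 hb.2 (by simpa using hw)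
      have haw : a ≠ w := fun h => hw (h ▸ ha.2)
      have hbw : b ≠ w := fun h => hw (h ▸ hb.2)
      simp [ha.1, hb.1, hvw, hab, haw, hbw]
    · rwa [edgeFinset_blueGraph, Fintype.card_fin]
  induction e with
  | _ a b =>
    obtain ⟨hab, hc⟩ : a ≠ b ∧ c s(a, b) = true := by simpa [redEdges] using he
    have h : (blueGraph n c).Adj a b := by rw [htop]; exact hab
    exact absurd (hc.symm.trans h.2) (by decide)
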